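/- arXiv:1706.06986 — 2 statements merged into one kernel-verified Lean document; each statement's English description precedes it below -/
import Mathlib

section
/- For any short exact sequence 0 → A → E → B → 0 of Λ-modules, D(A) ∩ D(B) ⊆ D(E). -/
open scoped BigOperators

noncomputable section

/-- Dot product of a real vector with a dimension vector. -/
def dprod {n : ℕ} (x : Fin n → ℝ) (v : Fin n → ℕ) : ℝ := ∑ i, x i * (v i : ℝ)

/-- Slope of a dimension vector with respect to a linear stability function
`Z(x) = a·x + i b·x`. -/
def zslope {n : ℕ} (a b : Fin n → ℝ) (v : Fin n → ℕ) : ℝ := dprod a v / dprod b v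

/-- The semistability set `D(M)` of a module `M`, with respect to a dimension-vector
assignment `d`. -/
def DSet {Λ : Type} [Ring Λ] {n : ℕ}
    (d : (N : Type) → [AddCommGroup N] → [Module Λ N] → Fin n → ℕ)
    (M : Type) [AddCommGroup M] [Module Λ M] : Set (Fin n → ℝ) :=
  {x | dprod x (d M) = 0 ∧ ∀ M' : Submodule Λ M, dprod x (d ↥M') ≤ 0}

/-- A module is Schurian if it is nonzero and every nonzero endomorphism is invertible,
i.e. its endomorphism ring is a division algebra. -/
def Schurian (Λ : Type) [Ring Λ] (M : Type) [AddCommGroup M] [Module Λ M] : Prop :=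
  (∃ y : M, y ≠ 0) ∧ ∀ f : M →ₗ[Λ] M, f ≠ 0 → Function.Bijective f

/-- `X` belongs to `E(M)`: `X` admits a finite filtration with all subquotients
isomorphic to `M`. -/
def IsFiltered (Λ : Type) [Ring Λ] (M : Type) [AddCommGroup M] [Module Λ M]
    (X : Type) [AddCommGroup X] [Module Λ X] : Prop :=
  ∃ (k : ℕ) (F : Fin (k + 1) → Submodule Λ X), Monotone F ∧ F 0 = ⊥ ∧ F (Fin.last k) = ⊤ ∧
    ∀ i : Fin k, Nonempty
      ((↥(F i.succ) ⧸ Submodule.comap (F i.succ).subtype (F i.castSucc)) ≃ₗ[Λ] M)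

/-- Slope at time `t` of a dimension vector, for a nonlinear stability function
`Z_t(x) = a_t·x + i b_t·x`. -/
def muZ {n : ℕ} (a b : ℝ → Fin n → ℝ) (t : ℝ) (v : Fin n → ℕ) : ℝ :=
  dprod (a t) v / dprod (b t) v

/-- `M` is `Z_t`-semistable: every nonzero submodule has zslope at least that of `M`. -/
def Semistable {Λ : Type} [Ring Λ] {n : ℕ}
    (d : (N : Type) → [AddCommGroup N] → [Module Λ N] → Fin n → ℕ)
    (a b : ℝ → Fin n → ℝ) (t : ℝ)
    (M : Type) [AddCommGroup M] [Module Λ M] : Prop :=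
  ∀ M' : Submodule Λ M, M' ≠ ⊥ → muZ a b t (d M) ≤ muZ a b t (d ↥M')

/-- The nonlinear stability function given by `(a, b)` is green (for `Λ`): at every
semistable pair `(N, t₀)` (with `N` a nonzero finite-length `Λ`-module, `N`
`Z_{t₀}`-semistable and `μ_{t₀}(N) = t₀`), the derivative of `t ↦ μ_t(N)` at `t₀`
is `< 1`. -/
def ZGreen {Λ : Type} [Ring Λ] {n : ℕ}
    (d : (N : Type) → [AddCommGroup N] → [Module Λ N] → Fin n → ℕ)
    (a b : ℝ → Fin n → ℝ) : Prop :=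
  ∀ (N : Type) [AddCommGroup N] [Module Λ N] [IsNoetherian Λ N] [IsArtinian Λ N] (t₀ : ℝ),
    (∃ y : N, y ≠ 0) → Semistable d a b t₀ N → muZ a b t₀ (d N) = t₀ →
      deriv (fun t => muZ a b t (d N)) t₀ < 1

/-- `t₀(M)`: the smallest `t` with `μ_t(M) = t` (as an infimum). -/
def tzero {n : ℕ} (a b : ℝ → Fin n → ℝ) (v : Fin n → ℕ) : ℝ := sInf {t | muZ a b t v = t}

/-- `t₁(M)`: the smallest value of `t₀(M')` over nonzero submodules `M' ⊆ M`. -/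
def tone {Λ : Type} [Ring Λ] {n : ℕ}
    (d : (N : Type) → [AddCommGroup N] → [Module Λ N] → Fin n → ℕ)
    (a b : ℝ → Fin n → ℝ)
    (M : Type) [AddCommGroup M] [Module Λ M] : ℝ :=
  sInf {s : ℝ | ∃ M' : Submodule Λ M, M' ≠ ⊥ ∧ s = tzero a b (d ↥M')}

/-- The dot product with a real vector is additive in the dimension vector. -/
theorem dprod_add {n : ℕ} (x : Fin n → ℝ) (v w : Fin n → ℕ) :
    dprod x (v + w) = dprod x v + dprod x w := by
  simp [dprod, mul_add, Finset.sum_add_distrib]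

/-- The kernel of `M' → E → E ⧸ A` is the intersection of `A` and `M'`, seen as a submodule
of `A`. -/
def kerMkQCompSubtypeEquiv {Λ E : Type*} [Ring Λ] [AddCommGroup E] [Module Λ E]
    (A M' : Submodule Λ E) :
    ↥(LinearMap.ker (A.mkQ ∘ₗ M'.subtype)) ≃ₗ[Λ] ↥(M'.comap A.subtype) :=
  (M'.equivSubtypeMap _) ≪≫ₗ
    LinearEquiv.ofEq _ _ (by
      rw [LinearMap.ker_comp, Submodule.ker_mkQ, Submodule.map_comap_subtype,
        Submodule.map_comap_subtype, inf_comm]) ≪≫ₗ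
    (A.equivSubtypeMap (M'.comap A.subtype)).symm

/-- For any short exact sequence `0 → A → E → B → 0` of `Λ`-modules
(realized as a submodule `A ⊆ E` with quotient `B = E ⧸ A`), `D(A) ∩ D(B) ⊆ D(E)`. -/
theorem stmt2 (Λ : Type) [Ring Λ] {n : ℕ}
    (d : (N : Type) → [AddCommGroup N] → [Module Λ N] → Fin n → ℕ)
    (hiso : ∀ (N N' : Type) [AddCommGroup N] [Module Λ N] [AddCommGroup N'] [Module Λ N']
      [IsNoetherian Λ N] [IsArtinian Λ N], (N ≃ₗ[Λ] N') → d N = d N')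
    (hadd : ∀ (N : Type) [AddCommGroup N] [Module Λ N] [IsNoetherian Λ N] [IsArtinian Λ N]
      (A : Submodule Λ N), d ↥A + d (N ⧸ A) = d N)
    (hbot : ∀ (N : Type) [AddCommGroup N] [Module Λ N] [IsNoetherian Λ N] [IsArtinian Λ N],
      (∀ y : N, y = 0) → d N = 0)
    (E : Type) [AddCommGroup E] [Module Λ E] [IsNoetherian Λ E] [IsArtinian Λ E]
    (A : Submodule Λ E) :
    DSet d ↥A ∩ DSet d (E ⧸ A) ⊆ DSet d E := by
  rintro x ⟨⟨hA, hAsub⟩, hB, hBsub⟩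
  refine ⟨?_, fun M' => ?_⟩
  · rw [← hadd E A, dprod_add, hA, hB, add_zero]
  · let f : ↥M' →ₗ[Λ] E ⧸ A := A.mkQ ∘ₗ M'.subtype
    rw [← hadd ↥M' (LinearMap.ker f), dprod_add, hiso _ _ f.quotKerEquivRange,
      hiso _ _ (kerMkQCompSubtypeEquiv A M')]
    exact add_nonpos (hAsub _) (hBsub _)
end
end

section
/- Suppose M₁, ..., M_m are Schurian Λ-modules such that E(M₁), ..., E(M_m) form a finite Harder–Narasimhan system for mod-Λ (every module X has a unique filtration 0=X₀⊆...⊆X_m=X with X_k/X_{k−1} ∈ E(M_k)). Then the sequence M₁,...,M_m is maximal forward hom-orthogonal: Hom(M_i,M_j)=0 for i<j and no Schurian module can be inserted into the sequence preserving this property. -/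
open scoped BigOperators

noncomputable section

section Filtered

variable {Λ : Type} [Ring Λ] {M : Type} [AddCommGroup M] [Module Λ M]
  {X : Type} [AddCommGroup X] [Module Λ X]

lemma isFiltered_of_subsingleton [Subsingleton X] : IsFiltered Λ M X :=
  ⟨0, fun _ => ⊥, monotone_const, rfl, Subsingleton.elim _ _, fun i => i.elim0⟩

lemma subsingleton_subquotient {A B : Submodule Λ X} (h : B ≤ A) :
    Subsingleton (↥B ⧸ Submodule.comap B.subtype A) := by
  rw [Submodule.Quotient.subsingleton_iff, Submodule.comap_subtype_eq_top]
  exact h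

lemma le_of_subsingleton_subquotient {A B : Submodule Λ X}
    (h : Subsingleton (↥B ⧸ Submodule.comap B.subtype A)) : B ≤ A := by
  rwa [Submodule.Quotient.subsingleton_iff, Submodule.comap_subtype_eq_top] at h

/-- The subquotient `B / ⊥` is `B`. -/
def subquotientBotEquiv (B : Submodule Λ X) :
    (↥B ⧸ Submodule.comap B.subtype ⊥) ≃ₗ[Λ] B :=
  Submodule.quotEquivOfEqBot _ (by simp [Submodule.comap_bot])

/-- The subquotient `⊤ / A` is the quotient by `A`. -/
def subquotientTopEquiv (A : Submodule Λ X) :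
    (↥(⊤ : Submodule Λ X) ⧸ Submodule.comap (⊤ : Submodule Λ X).subtype A) ≃ₗ[Λ] X ⧸ A :=
  Submodule.Quotient.equiv _ _ Submodule.topEquiv (by
    ext x
    simp)

lemma isFiltered_of_equiv (e : X ≃ₗ[Λ] M) : IsFiltered Λ M X := by
  refine ⟨1, ![⊥, ⊤], ?_, rfl, rfl, fun i => ?_⟩
  · intro a b hab
    fin_cases a <;> fin_cases b <;> simp_all
  · obtain rfl : i = 0 := Subsingleton.elim _ _
    exact ⟨(subquotientBotEquiv ⊤).trans (Submodule.topEquiv.trans e)⟩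

lemma IsFiltered.subsingleton_of_hom_to_eq_zero (hX : IsFiltered Λ M X)
    (h : ∀ f : M →ₗ[Λ] X, f = 0) : Subsingleton X := by
  obtain ⟨k, F, -, h0, h1, hq⟩ := hX
  have key : ∀ i, F i = ⊥ := by
    intro i
    induction i using Fin.induction with
    | zero => exact h0
    | succ i ih =>
      obtain ⟨e⟩ := hq i
      rw [ih] at e
      have hz := h ((F i.succ).subtype ∘ₗ
        ((subquotientBotEquiv (F i.succ)).symm.trans e).symm.toLinearMap)
      rw [eq_bot_iff]
      intro x hx
      obtain ⟨y, hy⟩ := ((subquotientBotEquiv (F i.succ)).symm.trans e).symm.surjective ⟨x, hx⟩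
      have := LinearMap.congr_fun hz y
      rw [LinearMap.comp_apply, LinearEquiv.coe_coe, hy] at this
      exact this
  rw [← Submodule.subsingleton_iff Λ, ← subsingleton_iff_bot_eq_top, ← h1, key]

lemma IsFiltered.subsingleton_of_hom_from_eq_zero (hX : IsFiltered Λ M X)
    (h : ∀ f : X →ₗ[Λ] M, f = 0) : Subsingleton X := by
  obtain ⟨k, F, -, h0, h1, hq⟩ := hX
  have key : ∀ i, F i = ⊤ := by
    intro i
    induction i using Fin.reverseInduction with
    | last => exact h1
    | cast i ih =>
      obtain ⟨e⟩ := hq i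
      rw [ih] at e
      have hz := h (((subquotientTopEquiv (F i.castSucc)).symm.trans e).toLinearMap ∘ₗ
        (F i.castSucc).mkQ)
      rw [eq_top_iff]
      intro x _
      have := LinearMap.congr_fun hz x
      simpa using this
  rw [← Submodule.subsingleton_iff Λ, ← subsingleton_iff_bot_eq_top, ← h0, key]

end Filtered

section TwoStep

variable {Λ : Type} [Ring Λ] {m : ℕ} {X : Type} [AddCommGroup X] [Module Λ X]

/-- The filtration of length `m` that jumps from `⊥` to `P` in step `i` and from `P` to `⊤`
in step `j`. -/
def twoStepFiltration (i j : Fin m) (P : Submodule Λ X) (l : Fin (m + 1)) : Submodule Λ X :=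
  if (l : ℕ) ≤ i then ⊥ else if (l : ℕ) ≤ j then P else ⊤

lemma isHNFiltration_twoStep (M : Fin m → Type) [∀ i, AddCommGroup (M i)]
    [∀ i, Module Λ (M i)] {i j : Fin m} (hij : i < j) (P : Submodule Λ X)
    (eP : P ≃ₗ[Λ] M i) (eQ : (X ⧸ P) ≃ₗ[Λ] M j) :
    Monotone (twoStepFiltration i j P) ∧ twoStepFiltration i j P 0 = ⊥ ∧
      twoStepFiltration i j P (Fin.last m) = ⊤ ∧
      ∀ l : Fin m, IsFiltered Λ (M l) (↥(twoStepFiltration i j P l.succ) ⧸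
        Submodule.comap (twoStepFiltration i j P l.succ).subtype
          (twoStepFiltration i j P l.castSucc)) := by
  have hij' : (i : ℕ) < j := hij
  refine ⟨?_, by simp [twoStepFiltration], ?_, fun l => ?_⟩
  · intro a b hab
    have hab' : (a : ℕ) ≤ b := hab
    unfold twoStepFiltration
    split_ifs <;> first | omega | simp
  · have := i.isLt
    have := j.isLt
    unfold twoStepFiltration
    rw [if_neg, if_neg] <;> simp
  · by_cases hi : l = i
    · subst hi
      have h1 : twoStepFiltration l j P l.castSucc = ⊥ := by simp [twoStepFiltration]
      have h2 : twoStepFiltration l j P l.succ = P := by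
        simp [twoStepFiltration, Nat.succ_le_of_lt hij']
      rw [h1, h2]
      exact isFiltered_of_equiv ((subquotientBotEquiv P).trans eP)
    by_cases hj : l = j
    · subst hj
      have h1 : twoStepFiltration i l P l.castSucc = P := by
        simp [twoStepFiltration, hij.not_ge]
      have h2 : twoStepFiltration i l P l.succ = ⊤ := by
        have : ¬ ((l : ℕ) + 1 ≤ i) := by omega
        simp [twoStepFiltration, this]
      rw [h1, h2]
      exact isFiltered_of_equiv ((subquotientTopEquiv P).trans eQ)
    · have hi' : (l : ℕ) ≠ i := fun h => hi (Fin.ext h)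
      have hj' : (l : ℕ) ≠ j := fun h => hj (Fin.ext h)
      have h : twoStepFiltration i j P l.succ ≤ twoStepFiltration i j P l.castSucc := by
        simp only [twoStepFiltration, Fin.val_succ, Fin.val_castSucc]
        split_ifs <;> first | omega | simp
      have := subsingleton_subquotient h
      exact isFiltered_of_subsingleton

end TwoStep

section Graph

variable {Λ : Type} [Ring Λ] {A B : Type} [AddCommGroup A] [Module Λ A]
  [AddCommGroup B] [Module Λ B]

/-- The graph of a linear map is isomorphic to its domain. -/
def graphEquivDomain (f : A →ₗ[Λ] B) : f.graph ≃ₗ[Λ] A :=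
  LinearEquiv.ofBijective (LinearMap.fst Λ A B ∘ₗ f.graph.subtype) (by
    constructor
    · rintro ⟨⟨a, b⟩, h⟩ ⟨⟨c, d⟩, h'⟩ e
      rw [LinearMap.mem_graph_iff] at h h'
      simp_all
    · exact fun a => ⟨⟨(a, f a), by simp [LinearMap.mem_graph_iff]⟩, rfl⟩)

/-- The quotient by the graph of a linear map is isomorphic to its codomain. -/
def quotientGraphEquiv (f : A →ₗ[Λ] B) : ((A × B) ⧸ f.graph) ≃ₗ[Λ] B :=
  (Submodule.quotEquivOfEq _ _ (LinearMap.graph_eq_ker_coprod f)).trans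
    (LinearMap.quotKerEquivOfSurjective _ (fun b => ⟨(0, b), by simp⟩))

end Graph

/-- If `M₁, ..., M_m` are Schurian `Λ`-modules such that
`E(M₁), ..., E(M_m)` form a finite Harder–Narasimhan system for `mod-Λ` (every module `X`
has a unique filtration `0 = X₀ ⊆ ... ⊆ X_m = X` with `X_k/X_{k−1} ∈ E(M_k)`), then the
sequence is maximal forward hom-orthogonal: `Hom(M_i, M_j) = 0` for `i < j`, and no
nonzero Schurian module can be inserted anywhere preserving this property. -/
theorem stmt18 (Λ : Type) [Ring Λ] (m : ℕ)
    (M : Fin m → Type) [∀ i, AddCommGroup (M i)] [∀ i, Module Λ (M i)]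
    [∀ i, IsNoetherian Λ (M i)] [∀ i, IsArtinian Λ (M i)]
    (hSch : ∀ i, Schurian Λ (M i))
    (hHN : ∀ (X : Type) [AddCommGroup X] [Module Λ X] [IsNoetherian Λ X] [IsArtinian Λ X],
      ∃! F : Fin (m + 1) → Submodule Λ X,
        Monotone F ∧ F 0 = ⊥ ∧ F (Fin.last m) = ⊤ ∧
        ∀ i : Fin m, IsFiltered Λ (M i)
          (↥(F i.succ) ⧸ Submodule.comap (F i.succ).subtype (F i.castSucc))) :
    (∀ i j : Fin m, i < j → ∀ f : M i →ₗ[Λ] M j, f = 0) ∧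
    (∀ (N : Type) [AddCommGroup N] [Module Λ N] [IsNoetherian Λ N] [IsArtinian Λ N],
      Schurian Λ N → ∀ k : ℕ, k ≤ m →
        ¬ ((∀ i : Fin m, (i : ℕ) < k → ∀ f : M i →ₗ[Λ] N, f = 0) ∧
           (∀ j : Fin m, k ≤ (j : ℕ) → ∀ g : N →ₗ[Λ] M j, g = 0))) := by
  refine ⟨fun i j hij f => ?_, ?_⟩
  · have hgraph (g : M i →ₗ[Λ] M j) :=
      isHNFiltration_twoStep M hij g.graph (graphEquivDomain g) (quotientGraphEquiv g)
    have h := congrFun ((hHN (M i × M j)).unique (hgraph f) (hgraph 0)) i.succ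
    have hij' : (i : ℕ) + 1 ≤ j := hij
    simp only [twoStepFiltration, Fin.val_succ, hij', if_true,
      if_neg (Nat.not_succ_le_self (i : ℕ))] at h
    ext x
    have hx : (x, f x) ∈ f.graph := by simp [LinearMap.mem_graph_iff]
    rw [h] at hx
    simpa [LinearMap.mem_graph_iff] using hx
  · rintro N _ _ _ _ ⟨⟨y, hy⟩, -⟩ k hk ⟨hto, hfrom⟩
    obtain ⟨F, ⟨-, h0, h1, hF⟩, -⟩ := hHN N
    have hbot : ∀ l : Fin (m + 1), (l : ℕ) ≤ k → F l = ⊥ := by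
      intro l
      induction l using Fin.induction with
      | zero => exact fun _ => h0
      | succ i ih =>
        intro hi
        rw [Fin.val_succ] at hi
        have hprev := ih (by rw [Fin.val_castSucc]; omega)
        have hQ := hF i
        rw [hprev] at hQ
        have hs := hQ.subsingleton_of_hom_to_eq_zero fun f => by
          have hz := hto i (by omega)
            (((F i.succ).subtype ∘ₗ (subquotientBotEquiv (F i.succ)).toLinearMap) ∘ₗ f)
          refine LinearMap.ext fun x => ((F i.succ).injective_subtype.comp
            (subquotientBotEquiv (F i.succ)).injective) ?_
          exact (LinearMap.congr_fun hz x).trans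
            ((F i.succ).subtype ∘ₗ (subquotientBotEquiv (F i.succ)).toLinearMap).map_zero.symm
        exact eq_bot_iff.2 (le_of_subsingleton_subquotient hs)
    have htop : ∀ l : Fin (m + 1), k ≤ (l : ℕ) → F l = ⊤ := by
      intro l
      induction l using Fin.reverseInduction with
      | last => exact fun _ => h1
      | cast i ih =>
        intro hi
        rw [Fin.val_castSucc] at hi
        have hnext := ih (by rw [Fin.val_succ]; omega)
        have hQ := hF i
        rw [hnext] at hQ
        have hs := hQ.subsingleton_of_hom_from_eq_zero fun f => by
          have hz := hfrom i hi
            (f ∘ₗ ((subquotientTopEquiv (F i.castSucc)).symm.toLinearMap ∘ₗ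
              (F i.castSucc).mkQ))
          refine LinearMap.ext fun q => ?_
          obtain ⟨x, rfl⟩ := ((subquotientTopEquiv (F i.castSucc)).symm.surjective.comp
            (Submodule.mkQ_surjective _)) q
          exact LinearMap.congr_fun hz x
        exact eq_top_iff.2 (le_of_subsingleton_subquotient hs)
    have hk' : k < m + 1 := Nat.lt_succ_of_le hk
    have hbt := (hbot ⟨k, hk'⟩ le_rfl).symm.trans (htop ⟨k, hk'⟩ le_rfl)
    exact hy ((Submodule.mem_bot Λ).1 (hbt ▸ Submodule.mem_top))
end
end
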